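/- Let PG(3) be the projective plane of order 3, realized as the 4-uniform hypergraph on {1, …, 13} with the thirteen blocks {10,11,12,13}, {10,1,2,3}, {10,4,5,6}, {10,7,8,9}, {11,1,4,7}, {11,2,5,8}, {11,3,6,9}, {12,1,5,9}, {12,2,6,7}, {12,3,4,8}, {13,1,6,8}, {13,2,4,9}, {13,3,5,7} (any two distinct blocks share exactly one element). Suppose p : {1, …, 13} → ℝ³ is injective and for every block b the four points p(b) are coplanar and each is an extreme point of Q_b := conv(p(b)), and Q_b ∩ Q_{b'} = p(b ∩ b') for all distinct blocks b, b'. Then for any two distinct blocks b, b', no 2-dimensional affine subspace of ℝ³ contains both Q_b and Q_{b'}. -/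

import Mathlib

/-- The thirteen blocks (lines) of the projective plane `PG(3)` of order 3,
on the point set `{1, …, 13}`. -/
def pg3Blocks : Finset (Finset ℕ) :=
  {{10, 11, 12, 13}, {10, 1, 2, 3}, {10, 4, 5, 6}, {10, 7, 8, 9},
   {11, 1, 4, 7}, {11, 2, 5, 8}, {11, 3, 6, 9},
   {12, 1, 5, 9}, {12, 2, 6, 7}, {12, 3, 4, 8},
   {13, 1, 6, 8}, {13, 2, 4, 9}, {13, 3, 5, 7}}

/-- If `b₁` and `b₂` both lie in the cone at `a` opposite to `a₁`, `a₂`, then the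
position of their directions and one size comparison force two connecting segments to cross. -/
lemma segment_inter_segment_nonempty_of_opposite_cone {E : Type*} [AddCommGroup E] [Module ℝ E]
    {a a₁ a₂ b₁ b₂ : E} {α₁ β₁ α₂ β₂ : ℝ}
    (hβ₁ : 0 < β₁) (hβ₂ : 0 < β₂)
    (h₁ : b₁ = a - α₁ • (a₁ - a) - β₁ • (a₂ - a))
    (h₂ : b₂ = a - α₂ • (a₁ - a) - β₂ • (a₂ - a))
    (hdet : β₂ * α₁ ≤ β₁ * α₂) (hβ : β₂ ≤ β₁) :
    (segment ℝ a b₁ ∩ segment ℝ a₁ b₂).Nonempty := by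
  have hD : 0 < β₁ + (β₁ * α₂ - β₂ * α₁) := by linarith
  have hD' := hD.ne'
  refine ⟨(1 - β₂ / (β₁ + (β₁ * α₂ - β₂ * α₁))) • a
      + (β₂ / (β₁ + (β₁ * α₂ - β₂ * α₁))) • b₁,
    ⟨_, _, ?_, by positivity, by ring, rfl⟩,
    ⟨(β₁ * α₂ - β₂ * α₁) / (β₁ + (β₁ * α₂ - β₂ * α₁)), β₁ / (β₁ + (β₁ * α₂ - β₂ * α₁)),
      div_nonneg (by linarith) hD.le, by positivity, ?_, ?_⟩⟩
  · rw [sub_nonneg, div_le_one hD]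
    linarith
  · field_simp
    ring
  · subst h₁ h₂
    match_scalars <;> field_simp <;> ring

/-- Two points in the cone at `a` opposite to `a₁`, `a₂` cannot be joined to `a`, `a₁`, `a₂`
without crossings. -/
lemma exists_crossing_of_opposite_cone {E : Type*} [AddCommGroup E] [Module ℝ E]
    {a a₁ a₂ b₁ b₂ : E} {α₁ β₁ α₂ β₂ : ℝ}
    (hα₁ : 0 < α₁) (hβ₁ : 0 < β₁) (hα₂ : 0 < α₂) (hβ₂ : 0 < β₂)
    (h₁ : b₁ = a - α₁ • (a₁ - a) - β₁ • (a₂ - a))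
    (h₂ : b₂ = a - α₂ • (a₁ - a) - β₂ • (a₂ - a)) :
    (segment ℝ a b₁ ∩ segment ℝ a₁ b₂).Nonempty ∨ (segment ℝ a b₂ ∩ segment ℝ a₂ b₁).Nonempty ∨
    (segment ℝ a b₂ ∩ segment ℝ a₁ b₁).Nonempty ∨
    (segment ℝ a b₁ ∩ segment ℝ a₂ b₂).Nonempty := by
  have h₁' : b₁ = a - β₁ • (a₂ - a) - α₁ • (a₁ - a) := by rw [h₁]; abel
  have h₂' : b₂ = a - β₂ • (a₂ - a) - α₂ • (a₁ - a) := by rw [h₂]; abel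
  rcases le_total (β₂ * α₁) (β₁ * α₂) with hdet | hdet
  · rcases le_total β₂ β₁ with hβ | hβ
    · exact .inl (segment_inter_segment_nonempty_of_opposite_cone hβ₁ hβ₂ h₁ h₂ hdet hβ)
    · refine .inr (.inl (segment_inter_segment_nonempty_of_opposite_cone hα₂ hα₁ h₂' h₁'
        (by linarith) ?_))
      by_contra! hlt
      nlinarith [mul_pos hβ₁ (sub_pos.2 hlt), mul_nonneg hα₁.le (sub_nonneg.2 hβ)]
  · rcases le_total β₁ β₂ with hβ | hβ
    · exact .inr (.inr (.inl
        (segment_inter_segment_nonempty_of_opposite_cone hβ₂ hβ₁ h₂ h₁ hdet hβ)))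
    · refine .inr (.inr (.inr (segment_inter_segment_nonempty_of_opposite_cone hα₁ hα₂ h₁' h₂'
        (by linarith) ?_)))
      by_contra! hlt
      nlinarith [mul_pos hβ₂ (sub_pos.2 hlt), mul_nonneg hα₂.le (sub_nonneg.2 hβ)]

lemma Fin.exists_others_three (m : Fin 3) :
    ∃ i k : Fin 3, i ≠ m ∧ k ≠ m ∧ i ≠ k ∧ (Finset.univ : Finset (Fin 3)) = {m, i, k} := by
  revert m
  decide

/-- A point of the plane of a triangle from which every vertex is visible has negative
barycentric coordinates at two of the vertices. -/
lemma exists_barycentric_neg_of_visible {E : Type*} [NormedAddCommGroup E] [NormedSpace ℝ E]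
    {a : Fin 3 → E} {b : E} {W : AffineSubspace ℝ E} (hW : Module.finrank ℝ W.direction = 2)
    (haW : ∀ i, a i ∈ W) (hbW : b ∈ W)
    (hext : ∀ m i k, i ≠ m → k ≠ m → a m ∉ segment ℝ (a i) (a k))
    (hb : b ∉ convexHull ℝ (Set.range a))
    (hvis : ∀ i, segment ℝ (a i) b ∩ convexHull ℝ (Set.range a) ⊆ {a i}) :
    ∃ c : Fin 3 → ℝ, ∑ i, c i = 1 ∧ b = ∑ i, c i • a i ∧ ∃ m, ∀ i, i ≠ m → c i < 0 := by
  have hind : AffineIndependent ℝ a := by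
    rw [affineIndependent_iff_not_collinear]
    intro hcol
    have hr : Set.range a = {a 0, a 1, a 2} := by
      ext x
      simp [Fin.exists_fin_succ, eq_comm]
    rw [hr] at hcol
    rcases hcol.wbtw_or_wbtw_or_wbtw with h | h | h
    · exact hext 1 0 2 (by decide) (by decide) (mem_segment_iff_wbtw.2 h)
    · exact hext 2 1 0 (by decide) (by decide) (mem_segment_iff_wbtw.2 h)
    · exact hext 0 2 1 (by decide) (by decide) (mem_segment_iff_wbtw.2 h)
  have : FiniteDimensional ℝ W.direction :=
    Module.finite_of_finrank_pos (by rw [hW]; norm_num)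
  have hspan : affineSpan ℝ (Set.range a) = W :=
    hind.affineSpan_eq_of_le_of_card_eq_finrank_add_one
      (affineSpan_le.2 (Set.range_subset_iff.2 haW)) (by simp [hW])
  rw [← hspan] at hbW
  obtain ⟨c, hc, hbc⟩ := eq_affineCombination_of_mem_affineSpan_of_fintype hbW
  rw [Finset.univ.affineCombination_eq_linear_combination a c hc] at hbc
  refine ⟨c, hc, hbc, ?_⟩
  by_contra! hno
  have hneg : ∃ m, c m < 0 := by
    by_contra! hpos
    exact hb (hbc ▸ (convex_convexHull ℝ _).sum_mem (fun i _ => hpos i) hc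
      fun i _ => subset_convexHull ℝ _ ⟨i, rfl⟩)
  obtain ⟨m, hm⟩ := hneg
  obtain ⟨i, him, hi⟩ := hno m
  obtain ⟨k, hki, hk⟩ := hno i
  have hkm : k ≠ m := by
    rintro rfl
    exact absurd hm hk.not_gt
  have huniv : (Finset.univ : Finset (Fin 3)) = {m, i, k} := by
    clear * - him hki hkm
    revert m i k
    decide
  rw [huniv, Finset.sum_insert (by simp [him.symm, hkm.symm]), Finset.sum_pair hki.symm] at hc hbc
  have hs : 0 < 1 - c m := by linarith
  have hs' := hs.ne'
  have hy : (c i / (1 - c m)) • a i + (c k / (1 - c m)) • a k ∈ segment ℝ (a i) (a k) :=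
    ⟨_, _, by positivity, by positivity, by rw [← add_div, div_eq_one_iff_eq hs']; linarith, rfl⟩
  have hy' : (c i / (1 - c m)) • a i + (c k / (1 - c m)) • a k ∈ segment ℝ (a m) b := by
    refine ⟨(-c m) / (1 - c m), 1 / (1 - c m), div_nonneg (by linarith) hs.le, by positivity,
      by rw [← add_div, div_eq_one_iff_eq hs']; ring, ?_⟩
    rw [hbc]
    match_scalars <;> field_simp
    ring
  have := hvis m ⟨hy', segment_subset_convexHull (Set.mem_range_self i) (Set.mem_range_self k) hy⟩
  exact hext m i k him hkm (Set.mem_singleton_iff.1 this ▸ hy)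

/-- Two disjoint coplanar triangles, the vertices of the second seeing all vertices of the first,
cannot be joined by the nine connecting segments without crossings. -/
lemma exists_crossing_of_disjoint_triangles {E : Type*} [NormedAddCommGroup E] [NormedSpace ℝ E]
    {a b : Fin 3 → E} {W : AffineSubspace ℝ E} (hW : Module.finrank ℝ W.direction = 2)
    (haW : ∀ i, a i ∈ W) (hbW : ∀ j, b j ∈ W)
    (hext : ∀ m i k, i ≠ m → k ≠ m → a m ∉ segment ℝ (a i) (a k))
    (hdisj : Disjoint (convexHull ℝ (Set.range a)) (convexHull ℝ (Set.range b)))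
    (hvis : ∀ i j, segment ℝ (a i) (b j) ∩ convexHull ℝ (Set.range a) ⊆ {a i}) :
    ∃ i i' j j', i ≠ i' ∧ j ≠ j' ∧
      (segment ℝ (a i) (b j) ∩ segment ℝ (a i') (b j')).Nonempty := by
  choose c hc hbc m hm using fun j => exists_barycentric_neg_of_visible hW haW (hbW j) hext
    (fun h => Set.disjoint_left.1 hdisj h (subset_convexHull ℝ _ ⟨j, rfl⟩)) fun i => hvis i j
  have hform : ∀ j i k, i ≠ m j → k ≠ m j → i ≠ k →
      (Finset.univ : Finset (Fin 3)) = {m j, i, k} →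
      b j = a (m j) - (-c j i) • (a i - a (m j)) - (-c j k) • (a k - a (m j)) := by
    intro j i k hi hk hik huniv
    have h1 := hc j
    have h2 := hbc j
    rw [huniv, Finset.sum_insert (by simp [hi.symm, hk.symm]), Finset.sum_pair hik] at h1 h2
    have h3 : c j (m j) = 1 - c j i - c j k := by linarith
    rw [h2, h3]
    module
  obtain ⟨f, u, v, hfa, huv, hfb⟩ := geometric_hahn_banach_compact_closed
    (convex_convexHull ℝ (Set.range b)) ((Set.finite_range b).isCompact_convexHull ℝ)
    (convex_convexHull ℝ (Set.range a)) ((Set.finite_range a).isClosed_convexHull ℝ) hdisj.symm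
  obtain ⟨M, hM⟩ := Finite.exists_max fun i => f (a i)
  have hmM : ∀ j, m j ≠ M := by
    intro j hj
    obtain ⟨i, k, hi, hk, hik, huniv⟩ := Fin.exists_others_three (m j)
    have h1 := congrArg f (hform j i k hi hk hik huniv)
    simp only [map_sub, map_smul, smul_eq_mul] at h1
    have h2 := hfa (b j) (subset_convexHull ℝ _ ⟨j, rfl⟩)
    have h3 := hfb (a (m j)) (subset_convexHull ℝ _ ⟨m j, rfl⟩)
    have hi' := hM i
    have hk' := hM k
    rw [← hj] at hi' hk'
    nlinarith [mul_nonneg (neg_nonneg.2 (hm j i hi).le) (sub_nonneg.2 hi'),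
      mul_nonneg (neg_nonneg.2 (hm j k hk).le) (sub_nonneg.2 hk')]
  have hninj : ¬ Function.Injective m := fun hinj =>
    let ⟨j, hj⟩ := Finite.surjective_of_injective hinj M
    hmM j hj
  obtain ⟨j, j', hmj, hjj⟩ := Function.not_injective_iff.1 hninj
  obtain ⟨i, k, hi, hk, hik, huniv⟩ := Fin.exists_others_three (m j)
  have hneg := hm j'
  have hb' := hform j' i k
  rw [← hmj] at hneg hb'
  rcases exists_crossing_of_opposite_cone (neg_pos.2 (hm j i hi)) (neg_pos.2 (hm j k hk))
    (neg_pos.2 (hneg i hi)) (neg_pos.2 (hneg k hk)) (hform j i k hi hk hik huniv)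
    (hb' hi hk hik huniv) with h | h | h | h
  · exact ⟨_, _, _, _, hi.symm, hjj, h⟩
  · exact ⟨_, _, _, _, hk.symm, hjj.symm, h⟩
  · exact ⟨_, _, _, _, hi.symm, hjj.symm, h⟩
  · exact ⟨_, _, _, _, hk.symm, hjj, h⟩

lemma pg3Blocks_subset_Icc : ∀ b ∈ pg3Blocks, b ⊆ Finset.Icc 1 13 := by
  decide

lemma card_of_mem_pg3Blocks : ∀ b ∈ pg3Blocks, b.card = 4 := by
  decide

lemma card_inter_of_mem_pg3Blocks :
    ∀ b ∈ pg3Blocks, ∀ b' ∈ pg3Blocks, b ≠ b' → (b ∩ b').card = 1 := by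
  decide

lemma exists_pg3Block_of_mem_Icc :
    ∀ x ∈ Finset.Icc 1 13, ∀ y ∈ Finset.Icc 1 13, ∃ b ∈ pg3Blocks, x ∈ b ∧ y ∈ b := by
  decide

lemma eq_of_mem_pg3Blocks {b b' : Finset ℕ} (hb : b ∈ pg3Blocks) (hb' : b' ∈ pg3Blocks)
    (hne : b ≠ b') {x y : ℕ} (hx : x ∈ b) (hx' : x ∈ b') (hy : y ∈ b) (hy' : y ∈ b') : x = y :=
  Finset.card_le_one.1 (card_inter_of_mem_pg3Blocks b hb b' hb' hne).le x
    (Finset.mem_inter.2 ⟨hx, hx'⟩) y (Finset.mem_inter.2 ⟨hy, hy'⟩)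

lemma exists_enum_pg3Block_sdiff {b : Finset ℕ} (hb : b ∈ pg3Blocks) {x : ℕ} (hx : x ∈ b) :
    ∃ a : Fin 3 → ℕ, Function.Injective a ∧ ∀ i, a i ∈ b ∧ a i ≠ x := by
  have hcard : (b.erase x).card = 3 := by
    rw [Finset.card_erase_of_mem hx, card_of_mem_pg3Blocks b hb]
  refine ⟨fun i => ((b.erase x).equivFinOfCardEq hcard).symm i, ?_, fun i => ?_⟩
  · exact Subtype.val_injective.comp (Equiv.injective _)
  · have := (((b.erase x).equivFinOfCardEq hcard).symm i).2
    exact ⟨Finset.mem_of_mem_erase this, Finset.ne_of_mem_erase this⟩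

/-- **Observation 2 of the paper.** In any realization of `PG(3)` by
convex quadrilaterals in ℝ³ (each block's four points being coplanar extreme points of
their convex hull `Q b`, with `Q b ∩ Q b' = p '' (b ∩ b')` for distinct blocks), no two
quadrilaterals are coplanar: no 2-dimensional affine subspace contains both. -/
theorem pg3_no_two_coplanar_quadrilaterals
    (p : ℕ → EuclideanSpace ℝ (Fin 3))
    (hp : Set.InjOn p (Set.Icc 1 13))
    (hquad : ∀ b ∈ pg3Blocks, Coplanar ℝ (p '' (b : Set ℕ)) ∧
      ∀ v ∈ b, p v ∉ convexHull ℝ ((convexHull ℝ (p '' (b : Set ℕ))) \ {p v}))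
    (hmeet : ∀ b ∈ pg3Blocks, ∀ b' ∈ pg3Blocks, b ≠ b' →
      convexHull ℝ (p '' (b : Set ℕ)) ∩ convexHull ℝ (p '' (b' : Set ℕ)) =
        p '' ((b ∩ b' : Finset ℕ) : Set ℕ)) :
    ∀ b ∈ pg3Blocks, ∀ b' ∈ pg3Blocks, b ≠ b' →
      ∀ W : AffineSubspace ℝ (EuclideanSpace ℝ (Fin 3)),
        Module.finrank ℝ W.direction = 2 →
        ¬ (convexHull ℝ (p '' (b : Set ℕ)) ⊆ (W : Set (EuclideanSpace ℝ (Fin 3))) ∧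
           convexHull ℝ (p '' (b' : Set ℕ)) ⊆ (W : Set (EuclideanSpace ℝ (Fin 3)))) := by
  rintro B hB B' hB' hne W hW ⟨hBW, hBW'⟩
  have hinj : ∀ b ∈ pg3Blocks, ∀ b' ∈ pg3Blocks, ∀ x ∈ b, ∀ y ∈ b', x ≠ y → p x ≠ p y := by
    intro b hb b' hb' x hx y hy hxy h
    exact hxy (hp (by simpa using pg3Blocks_subset_Icc b hb hx)
      (by simpa using pg3Blocks_subset_Icc b' hb' hy) h)
  have hmem : ∀ b : Finset ℕ, ∀ x ∈ b, p x ∈ convexHull ℝ (p '' (b : Set ℕ)) := fun b x hx =>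
    subset_convexHull ℝ _ ⟨x, hx, rfl⟩
  have hext : ∀ b ∈ pg3Blocks, ∀ x ∈ b, ∀ s : Set (EuclideanSpace ℝ (Fin 3)),
      (∀ z ∈ s, ∃ y ∈ b, y ≠ x ∧ p y = z) → p x ∉ convexHull ℝ s := by
    intro b hb x hx s hs hxs
    refine (hquad b hb).2 x hx (convexHull_mono ?_ hxs)
    intro z hz
    obtain ⟨y, hy, hyx, rfl⟩ := hs z hz
    exact ⟨hmem b y hy, hinj b hb b hb y hy x hx hyx⟩
  have hseg : ∀ b ∈ pg3Blocks, ∀ x ∈ b, ∀ y ∈ b, ∀ z ∈ b, p x ∈ segment ℝ (p y) (p z) →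
      x = y ∨ x = z := by
    intro b hb x hx y hy z hz hxs
    by_contra! h
    rw [← convexHull_pair] at hxs
    refine hext b hb x hx _ ?_ hxs
    rintro w (rfl | rfl)
    · exact ⟨y, hy, h.1.symm, rfl⟩
    · exact ⟨z, hz, h.2.symm, rfl⟩
  obtain ⟨x, hx⟩ := Finset.card_eq_one.1 (card_inter_of_mem_pg3Blocks B hB B' hB' hne)
  obtain ⟨hxB, hxB'⟩ := Finset.mem_inter.1 (hx ▸ Finset.mem_singleton_self x : x ∈ B ∩ B')
  obtain ⟨a, ha, haB⟩ := exists_enum_pg3Block_sdiff hB hxB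
  obtain ⟨b, hb, hbB⟩ := exists_enum_pg3Block_sdiff hB' hxB'
  have haB' : ∀ i, a i ∉ B' := fun i h =>
    (haB i).2 (eq_of_mem_pg3Blocks hB hB' hne (haB i).1 h hxB hxB')
  have hbB' : ∀ j, b j ∉ B := fun j h =>
    (hbB j).2 (eq_of_mem_pg3Blocks hB hB' hne h (hbB j).1 hxB hxB')
  choose C hC haC hbC using fun i j => exists_pg3Block_of_mem_Icc (a i)
    (pg3Blocks_subset_Icc B hB (haB i).1) (b j) (pg3Blocks_subset_Icc B' hB' (hbB j).1)
  have hCB : ∀ i j, C i j ≠ B := fun i j h => hbB' j (h ▸ hbC i j)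
  have hCseg : ∀ i j, segment ℝ (p (a i)) (p (b j)) ⊆ convexHull ℝ (p '' (C i j : Set ℕ)) :=
    fun i j => (convex_convexHull ℝ _).segment_subset (hmem _ _ (haC i j)) (hmem _ _ (hbC i j))
  have hconv : ∀ (s : Fin 3 → ℕ) (D : Finset ℕ), (∀ i, s i ∈ D) →
      convexHull ℝ (Set.range fun i => p (s i)) ⊆ convexHull ℝ (p '' (D : Set ℕ)) := by
    intro s D hs
    refine convexHull_mono ?_
    rintro _ ⟨i, rfl⟩
    exact ⟨s i, hs i, rfl⟩
  obtain ⟨i, i', j, j', hi, hj, y, hy, hy'⟩ := exists_crossing_of_disjoint_triangles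
    (a := fun i => p (a i)) (b := fun j => p (b j)) hW
    (fun i => hBW (hmem B _ (haB i).1)) (fun j => hBW' (hmem B' _ (hbB j).1))
    (fun m i k hi hk h => (hseg B hB _ (haB m).1 _ (haB i).1 _ (haB k).1 h).elim
      (fun h => hi (ha h).symm) fun h => hk (ha h).symm)
    (by
      rw [Set.disjoint_left]
      intro y hya hyb
      have hyx : y ∈ p '' ((B ∩ B' : Finset ℕ) : Set ℕ) := hmeet B hB B' hB' hne ▸
        ⟨hconv a B (fun i => (haB i).1) hya, hconv b B' (fun j => (hbB j).1) hyb⟩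
      rw [hx, Finset.coe_singleton, Set.image_singleton, Set.mem_singleton_iff] at hyx
      refine hext B hB x hxB _ ?_ (hyx ▸ hya)
      rintro _ ⟨i, rfl⟩
      exact ⟨a i, (haB i).1, (haB i).2, rfl⟩)
    (by
      rintro i j y ⟨hy, hya⟩
      have hyC : y ∈ p '' ((C i j ∩ B : Finset ℕ) : Set ℕ) :=
        hmeet _ (hC i j) B hB (hCB i j) ▸ ⟨hCseg i j hy, hconv a B (fun i => (haB i).1) hya⟩
      obtain ⟨z, hz, rfl⟩ := hyC
      obtain ⟨hz, hz'⟩ := Finset.mem_inter.1 (Finset.mem_coe.1 hz)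
      rw [eq_of_mem_pg3Blocks (hC i j) hB (hCB i j) hz hz' (haC i j) (haB i).1]
      rfl)
  have hCC : C i j ≠ C i' j' := fun h =>
    hi (ha (eq_of_mem_pg3Blocks (hC i j) hB (hCB i j) (haC i j) (haB i).1
      (h ▸ haC i' j') (haB i').1))
  have hyC : y ∈ p '' ((C i j ∩ C i' j' : Finset ℕ) : Set ℕ) :=
    hmeet _ (hC i j) _ (hC i' j') hCC ▸ ⟨hCseg i j hy, hCseg i' j' hy'⟩
  obtain ⟨z, hz, rfl⟩ := hyC
  obtain ⟨hz, hz'⟩ := Finset.mem_inter.1 (Finset.mem_coe.1 hz)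
  rcases hseg _ (hC i j) z hz _ (haC i j) _ (hbC i j) hy with h | h <;>
  rcases hseg _ (hC i' j') z hz' _ (haC i' j') _ (hbC i' j') hy' with h' | h'
  · exact hi (ha (h.symm.trans h'))
  · exact hbB' j' (h'.symm.trans h ▸ (haB i).1)
  · exact hbB' j (h.symm.trans h' ▸ (haB i').1)
  · exact hj (hb (h.symm.trans h'))
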